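/- arXiv:1310.2930 — 2 statements merged into one kernel-verified Lean document; each statement's English description precedes it below -/
import Mathlib

section
/- Let ν = β + (s^s) + α be a partition of type 2 such that the partition ν_{(s)} = (ν_{s+1}, ν_{s+2}, …), obtained from ν by deleting its first s rows, is corner-symmetric. If μ is a partition with ν ⊆ μ, |μ| = |ν| + 1, and μ ≠ β + (s^s, 1) + α, then μ does not cover ν. -/
/-- A partition, 0-indexed: `f i` is the `(i+1)`-st part. A partition is a weakly
decreasing, eventually zero function `ℕ → ℕ`. -/
def IsPartition (f : ℕ → ℕ) : Prop := Antitone f ∧ ∃ N, f N = 0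

/-- The number of (nonzero) parts of a partition. -/
noncomputable def plen (f : ℕ → ℕ) : ℕ := sInf {n | f n = 0}

/-- The size (weight) of a partition: the sum of its parts. -/
noncomputable def psize (f : ℕ → ℕ) : ℕ := ∑ i ∈ Finset.range (plen f), f i

/-- Containment of partitions: `subP f g` means `f ⊆ g`, i.e. `f i ≤ g i` for all `i`. -/
def subP (f g : ℕ → ℕ) : Prop := ∀ i, f i ≤ g i

/-- The conjugate partition: `conjP f j = #{i : f i > j}` (0-indexed). -/
noncomputable def conjP (f : ℕ → ℕ) : ℕ → ℕ := fun j => Nat.card {i : ℕ // j < f i}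

/-- The square partition `(s^s)`. -/
def squareP (s : ℕ) : ℕ → ℕ := fun j => if j < s then s else 0

/-- The partition `(s^s, 1)`: `s` parts equal to `s` followed by a part equal to `1`. -/
def squareP1 (s : ℕ) : ℕ → ℕ := fun j => if j < s then s else if j = s then 1 else 0

/-- The complement of `f` in the square `(m^m)`: the `(i+1)`-st part (0-indexed `i < m`)
is `m - f (m - 1 - i)`. -/
def complP (m : ℕ) (f : ℕ → ℕ) : ℕ → ℕ := fun i => if i < m then m - f (m - 1 - i) else 0

/-- `ν + (1)`: add one box at the end of the first row. -/
def addRow1 (f : ℕ → ℕ) : ℕ → ℕ := fun j => if j = 0 then f 0 + 1 else f j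

/-- `(ν, 1)`: append a part equal to `1` after the last nonzero part. -/
noncomputable def addPart1 (f : ℕ → ℕ) : ℕ → ℕ :=
  fun j => if j < plen f then f j else if j = plen f then 1 else 0

/-- Delete the first `k` columns of a partition. -/
def colDel (k : ℕ) (f : ℕ → ℕ) : ℕ → ℕ := fun j => f j - k

/-- Delete the first `s` rows of a partition. -/
def rowDel (s : ℕ) (f : ℕ → ℕ) : ℕ → ℕ := fun j => f (j + s)

/-- The sequence whose first `m` entries are given by `f` and whose subsequent entries
are given by `g`; used to form `(η^{c,m} + γ, σ)`. -/
def appendAfter (m : ℕ) (f g : ℕ → ℕ) : ℕ → ℕ := fun i => if i < m then f i else g (i - m)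

/-- The cell in row `r`, column `c` (both 0-indexed) belongs to the skew diagram
`lam/alpha`. -/
def inShape (lam alpha : ℕ → ℕ) (r c : ℕ) : Prop := alpha r ≤ c ∧ c < lam r

/-- A Littlewood–Richardson tableau of shape `lam/alpha` and content `beta`
(for each `k`, there are `beta k` entries equal to `k + 1`): a semistandard filling of
the skew diagram whose reverse reading word is a lattice permutation.  The lattice
condition is expressed by comparing, in every prefix of the reverse reading word ending
at a cell `(r, c)` (all cells in rows above `r`, together with the cells in row `r`
weakly to the right of column `c`), the number of entries `k + 2` with the number of
entries `k + 1`. -/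
structure LRTableau (lam alpha beta : ℕ → ℕ) where
  entry : ℕ → ℕ → ℕ
  zero_outside : ∀ r c, ¬ inShape lam alpha r c → entry r c = 0
  one_le : ∀ r c, inShape lam alpha r c → 1 ≤ entry r c
  row_weak : ∀ r c₁ c₂, c₁ ≤ c₂ → inShape lam alpha r c₁ → inShape lam alpha r c₂ →
    entry r c₁ ≤ entry r c₂
  col_strict : ∀ r₁ r₂ c, r₁ < r₂ → inShape lam alpha r₁ c → inShape lam alpha r₂ c →
    entry r₁ c < entry r₂ c
  content : ∀ k : ℕ,
    Nat.card {p : ℕ × ℕ // inShape lam alpha p.1 p.2 ∧ entry p.1 p.2 = k + 1} = beta k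
  lattice : ∀ r c k : ℕ, inShape lam alpha r c →
    Nat.card {p : ℕ × ℕ // inShape lam alpha p.1 p.2 ∧
        (p.1 < r ∨ (p.1 = r ∧ c ≤ p.2)) ∧ entry p.1 p.2 = k + 2} ≤
    Nat.card {p : ℕ × ℕ // inShape lam alpha p.1 p.2 ∧
        (p.1 < r ∨ (p.1 = r ∧ c ≤ p.2)) ∧ entry p.1 p.2 = k + 1}

open Classical in
/-- The Littlewood–Richardson coefficient `c^lam_{alpha, beta}`: the number of LR
tableaux of shape `lam/alpha` and content `beta`, or `0` if `alpha ⊄ lam`. -/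
noncomputable def LRcoeff (lam alpha beta : ℕ → ℕ) : ℕ :=
  if subP alpha lam then Nat.card (LRTableau lam alpha beta) else 0

/-- `mu` covers `nu`: for every integer `m ≥ μ₁ + ℓ(μ)` and every partition `lam`,
`c^lam_{ν^{c,m}, ν'} ≤ c^lam_{μ^{c,m}, μ'}`, i.e. `s_{μ'} s_{μ^c} - s_{ν'} s_{ν^c}`
is Schur-positive (complements taken in `(m^m)`). -/
def Covers (mu nu : ℕ → ℕ) : Prop :=
  ∀ m : ℕ, mu 0 + plen mu ≤ m → ∀ lam : ℕ → ℕ, IsPartition lam →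
    LRcoeff lam (complP m nu) (conjP nu) ≤ LRcoeff lam (complP m mu) (conjP mu)

/-- The partition `(i^{s+1}, i, i-1, ..., 2, 1)` (as a 0-indexed function). -/
def betaShape (i s : ℕ) : ℕ → ℕ := fun j => if j ≤ s + 1 then i else i + s + 1 - j

/-- A partition is of type 1 if it contains `(i, i, i-1, ..., 2, 1)` where `i` is its
first part. -/
def Type1 (nu : ℕ → ℕ) : Prop := IsPartition nu ∧ subP (betaShape (nu 0) 0) nu

/-- `nu = beta + (s^s) + alpha` (componentwise) is a type-2 decomposition: `s ≥ 1`,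
`alpha` is a nonempty partition with at most `s` parts, and `beta` is a (possibly empty)
partition containing `(i^{s+1}, i, i-1, ..., 2, 1)` where `i = beta 0`. -/
def IsType2Decomp (nu beta : ℕ → ℕ) (s : ℕ) (alpha : ℕ → ℕ) : Prop :=
  IsPartition beta ∧ IsPartition alpha ∧ 1 ≤ s ∧ alpha 0 ≠ 0 ∧ plen alpha ≤ s ∧
    subP (betaShape (beta 0) s) beta ∧ ∀ j, nu j = beta j + squareP s j + alpha j

/-- A partition is of type 2 if it admits a type-2 decomposition. -/
def Type2 (nu : ℕ → ℕ) : Prop := ∃ beta s alpha, IsType2Decomp nu beta s alpha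

/-- A self-conjugate partition. -/
def SelfConjugate (t : ℕ → ℕ) : Prop := ∀ j, conjP t j = t j

/-- A partition `nu` is corner-symmetric if for every outer corner of `nu` in row
`r + 1 ≥ 2` (1-indexed), i.e. every 0-indexed row `r ≥ 1` with `nu r < nu (r-1)`
(the corner cell lying in 0-indexed column `nu r`), there is a nonempty partition
`η ⊆ nu` such that the skew diagram `nu/η` is, up to translation, the Young diagram of
a self-conjugate partition, contains the cell `(r-1, nu r)` (0-indexed), and contains
no cell in any column of 0-indexed column index `< nu r`. -/
def CornerSymmetric (nu : ℕ → ℕ) : Prop :=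
  ∀ r : ℕ, 1 ≤ r → nu r < nu (r - 1) →
    ∃ η : ℕ → ℕ, IsPartition η ∧ subP η nu ∧ η 0 ≠ 0 ∧
      ∃ t : ℕ → ℕ, ∃ r0 c0 : ℕ, IsPartition t ∧ SelfConjugate t ∧
        (∀ a b : ℕ, (η a ≤ b ∧ b < nu a) ↔ (r0 ≤ a ∧ c0 ≤ b ∧ b - c0 < t (a - r0))) ∧
        η (r - 1) ≤ nu r ∧
        (∀ a b : ℕ, η a ≤ b → b < nu a → nu r ≤ b)

theorem IsPartition.lt_conjP {f : ℕ → ℕ} (hf : IsPartition f) (i j : ℕ) :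
    i < conjP f j ↔ j < f i := by
  obtain ⟨hanti, N, hN⟩ := hf
  have hex : ∃ n, f n ≤ j := ⟨N, by omega⟩
  classical
  have key : ∀ i, j < f i ↔ i < Nat.find hex := by
    intro i
    rw [Nat.lt_find_iff]
    constructor
    · intro h k hk h'
      have := hanti hk
      omega
    · intro h
      have := h i le_rfl
      omega
  have hcard : conjP f j = Nat.find hex := by
    unfold conjP
    rw [Nat.card_congr (Equiv.subtypeEquivRight key),
      Nat.subtype_card (Finset.range (Nat.find hex)) fun _ => Finset.mem_range,
      Finset.card_range]
  rw [hcard, key]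

theorem IsPartition.eq_zero_of_plen_le {f : ℕ → ℕ} (hf : IsPartition f) {i : ℕ}
    (hi : plen f ≤ i) : f i = 0 := by
  have h0 : f (plen f) = 0 := Nat.sInf_mem (s := {n | f n = 0}) hf.2
  have := hf.1 hi
  omega

theorem IsPartition.psize_eq {f : ℕ → ℕ} (hf : IsPartition f) {N : ℕ} (hN : plen f ≤ N) :
    psize f = ∑ i ∈ Finset.range N, f i := by
  unfold psize
  apply Finset.sum_subset
  · intro i hi
    simp only [Finset.mem_range] at *
    omega
  · intro i _ hi
    apply hf.eq_zero_of_plen_le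
    simpa using hi

theorem exists_row_of_psize_succ {nu mu : ℕ → ℕ} (hnu : IsPartition nu) (hmu : IsPartition mu)
    (hsub : subP nu mu) (hsz : psize mu = psize nu + 1) :
    ∃ r, mu r = nu r + 1 ∧ ∀ j, j ≠ r → mu j = nu j := by
  set N := max (plen nu) (plen mu) with hN
  rw [hmu.psize_eq (le_max_right (plen nu) (plen mu)),
    hnu.psize_eq (le_max_left (plen nu) (plen mu)), ← hN] at hsz
  have hex : ∃ r ∈ Finset.range N, nu r < mu r := by
    by_contra! hcon
    have := Finset.sum_le_sum hcon
    omega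
  obtain ⟨r, hr, hlt⟩ := hex
  rw [← Finset.add_sum_erase _ _ hr, ← Finset.add_sum_erase _ nu hr] at hsz
  have hle : ∀ i ∈ (Finset.range N).erase r, nu i ≤ mu i := fun i _ => hsub i
  have hsum := Finset.sum_le_sum hle
  have heq : ∑ i ∈ (Finset.range N).erase r, nu i = ∑ i ∈ (Finset.range N).erase r, mu i := by
    omega
  have hall := (Finset.sum_eq_sum_iff_of_le hle).1 heq
  refine ⟨r, by omega, fun j hj => ?_⟩
  by_cases hjN : j < N
  · exact (hall j (by simp [hj, hjN])).symm
  · rw [hmu.eq_zero_of_plen_le (by omega), hnu.eq_zero_of_plen_le (by omega)]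

/-- The partition `η^{c,m} + η'`. -/
noncomputable def complAddConj (m : ℕ) (eta : ℕ → ℕ) : ℕ → ℕ :=
  fun i => complP m eta i + conjP eta i

theorem IsPartition.complAddConj {eta : ℕ → ℕ} (h : IsPartition eta) (m : ℕ) :
    IsPartition (complAddConj m eta) := by
  constructor
  · intro a b hab
    have h1 : conjP eta b ≤ conjP eta a := by
      by_contra! hcon
      have h1 := (h.lt_conjP _ _).1 hcon
      have h2 : ¬ conjP eta a < conjP eta a := lt_irrefl _
      rw [h.lt_conjP] at h2
      omega
    have h2 : complP m eta b ≤ complP m eta a := by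
      unfold complP
      have := h.1 (show m - 1 - b ≤ m - 1 - a by omega)
      split_ifs <;> omega
    exact Nat.add_le_add h2 h1
  · refine ⟨max m (eta 0), ?_⟩
    have h1 : complP m eta (max m (eta 0)) = 0 := by
      unfold complP
      rw [if_neg (by simp)]
    have h2 : ¬ 0 < conjP eta (max m (eta 0)) := by
      rw [h.lt_conjP]
      simp
    show complP m eta _ + conjP eta _ = 0
    omega

/-- The diagram of `(η^{c,m} + η') / N^{c,m}` is the disjoint union of a translate of `η'` and
of `N / η` rotated by a half turn. -/
theorem inShape_complAddConj_iff {eta N : ℕ → ℕ} {m K : ℕ} (heta : IsPartition eta)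
    (hN : IsPartition N) (hsub : subP eta N) (hm : N 0 + K ≤ m) (hK : N K = 0) (r c : ℕ) :
    inShape (complAddConj m eta) (complP m N) r c ↔
      (m ≤ c ∧ r < eta (c - m)) ∨
      (r < m ∧ c < m ∧ eta (m - 1 - r) ≤ m - 1 - c ∧ m - 1 - c < N (m - 1 - r)) := by
  have hc := heta.lt_conjP
  unfold inShape complAddConj complP
  have e0 := hsub 0
  by_cases hr : r < m
  · rw [if_pos hr, if_pos hr]
    have hN0 := hN.1 (Nat.zero_le (m - 1 - r))
    have hs := hsub (m - 1 - r)
    by_cases hz : K ≤ m - 1 - r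
    · have := hN.1 hz
      have hcc := hc (c - m) r
      by_cases hcm : m ≤ c <;> omega
    · have hcc := hc 0 r
      have := heta.1 (Nat.zero_le (c - m))
      omega
  · rw [if_neg hr, if_neg hr]
    have hcc := hc 0 r
    have := heta.1 (Nat.zero_le (c - m))
    omega

theorem finite_inShape {lam : ℕ → ℕ} (h : IsPartition lam) (alpha : ℕ → ℕ) :
    {p : ℕ × ℕ | inShape lam alpha p.1 p.2}.Finite := by
  obtain ⟨N, hN⟩ := h.2
  refine (Finset.range N ×ˢ Finset.range (lam 0)).finite_toSet.subset ?_
  rintro ⟨r, c⟩ ⟨_, h2⟩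
  have h0 := h.1 (Nat.zero_le r)
  have h1 : r < N := by
    by_contra! hcon
    have := h.1 hcon
    simp only at h2
    omega
  simp only [Finset.coe_product, Finset.coe_range, Set.mem_prod, Set.mem_Iio] at *
  omega

theorem finite_inShape_and {lam : ℕ → ℕ} (h : IsPartition lam) (alpha : ℕ → ℕ)
    (P : ℕ × ℕ → Prop) : {p : ℕ × ℕ | inShape lam alpha p.1 p.2 ∧ P p}.Finite :=
  (finite_inShape h alpha).subset fun _ hp => hp.1

theorem LRTableau.entry_le {lam alpha beta : ℕ → ℕ} (hlam : IsPartition lam) {B : ℕ}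
    (hB : ∀ k, B ≤ k → beta k = 0) (T : LRTableau lam alpha beta) (r c : ℕ) :
    T.entry r c ≤ B := by
  by_contra! hcon
  have hin : inShape lam alpha r c := by
    by_contra h
    have := T.zero_outside r c h
    omega
  have hcard := T.content (T.entry r c - 1)
  rw [hB _ (by omega)] at hcard
  have hfin : Finite {p : ℕ × ℕ //
      inShape lam alpha p.1 p.2 ∧ T.entry p.1 p.2 = T.entry r c - 1 + 1} :=
    (finite_inShape_and hlam alpha _).to_subtype
  exact (Finite.card_eq_zero_iff.1 hcard).false ⟨(r, c), hin, by simp only; omega⟩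

theorem LRTableau.finite {lam alpha beta : ℕ → ℕ} (hlam : IsPartition lam) {B : ℕ}
    (hB : ∀ k, B ≤ k → beta k = 0) : Finite (LRTableau lam alpha beta) := by
  have := (finite_inShape hlam alpha).to_subtype
  let F : LRTableau lam alpha beta →
      ({p : ℕ × ℕ | inShape lam alpha p.1 p.2} → Fin (B + 1)) :=
    fun T p => ⟨T.entry p.1.1 p.1.2, Nat.lt_succ_of_le (T.entry_le hlam hB _ _)⟩
  refine Finite.of_injective F fun T U hTU => ?_
  have he : T.entry = U.entry := by
    funext r c
    by_cases h : inShape lam alpha r c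
    · exact congrArg Fin.val (congrFun hTU ⟨(r, c), h⟩)
    · rw [T.zero_outside r c h, U.zero_outside r c h]
  cases T
  cases U
  simp only at he
  subst he
  rfl

/-- A filling is an LR tableau of content `N'` as soon as its cells can be matched with the cells
of `N`, the entries recording the columns of `N`, so that each row of `N` is matched with cells
that go down. -/
theorem nonempty_LRTableau_of_matching {lam alpha N : ℕ → ℕ} (hlam : IsPartition lam)
    (entry : ℕ → ℕ → ℕ) (label : ℕ × ℕ → ℕ) (cell : ℕ → ℕ → ℕ × ℕ)
    (zero_outside : ∀ r c, ¬ inShape lam alpha r c → entry r c = 0)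
    (one_le : ∀ r c, inShape lam alpha r c → 1 ≤ entry r c)
    (row_weak : ∀ r c₁ c₂, c₁ ≤ c₂ → inShape lam alpha r c₁ → inShape lam alpha r c₂ →
      entry r c₁ ≤ entry r c₂)
    (col_strict : ∀ r₁ r₂ c, r₁ < r₂ → inShape lam alpha r₁ c → inShape lam alpha r₂ c →
      entry r₁ c < entry r₂ c)
    (label_spec : ∀ r c v, inShape lam alpha r c → entry r c = v + 1 →
      v < N (label (r, c)) ∧ cell (label (r, c)) v = (r, c))
    (cell_spec : ∀ p v, v < N p → inShape lam alpha (cell p v).1 (cell p v).2 ∧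
      entry (cell p v).1 (cell p v).2 = v + 1 ∧ label (cell p v) = p)
    (cell_lt : ∀ p v, v + 1 < N p → (cell p v).1 < (cell p (v + 1)).1) :
    Nonempty (LRTableau lam alpha (conjP N)) := by
  refine ⟨⟨entry, zero_outside, one_le, row_weak, col_strict, ?_, ?_⟩⟩
  · intro k
    refine Nat.card_congr
      { toFun := fun x => ⟨label x.1, (label_spec _ _ _ x.2.1 x.2.2).1⟩
        invFun := fun p => ⟨cell p.1 k, (cell_spec _ _ p.2).1, (cell_spec _ _ p.2).2.1⟩
        left_inv := fun x => Subtype.ext (label_spec _ _ _ x.2.1 x.2.2).2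
        right_inv := fun p => Subtype.ext (cell_spec _ _ p.2).2.2 }
  · intro r c k _
    have hfin : Finite {p : ℕ × ℕ // inShape lam alpha p.1 p.2 ∧
        (p.1 < r ∨ (p.1 = r ∧ c ≤ p.2)) ∧ entry p.1 p.2 = k + 1} :=
      (finite_inShape_and hlam alpha _).to_subtype
    refine Nat.card_le_card_of_injective (fun x => ⟨cell (label x.1) k, ?_⟩) ?_
    · obtain ⟨⟨a, b⟩, hin, hpre, he⟩ := x
      obtain ⟨h1, h2⟩ := label_spec _ _ _ hin he
      obtain ⟨h3, h4, _⟩ := cell_spec (label (a, b)) k (by simp only at h1; omega)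
      have h5 := cell_lt _ _ h1
      rw [h2] at h5
      refine ⟨h3, ?_, h4⟩
      simp only at *
      omega
    · rintro ⟨⟨a, b⟩, hin, hpre, he⟩ ⟨⟨a', b'⟩, hin', hpre', he'⟩ hxy
      obtain ⟨h1, h2⟩ := label_spec _ _ _ hin he
      obtain ⟨h1', h2'⟩ := label_spec _ _ _ hin' he'
      have e := congrArg label (congrArg Subtype.val hxy)
      simp only at e h1 h1' h2 h2'
      rw [(cell_spec (label (a, b)) k (by omega)).2.2,
        (cell_spec (label (a', b')) k (by omega)).2.2] at e
      apply Subtype.ext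
      show (a, b) = (a', b')
      rw [← h2, ← h2', e]

/-- If the row lengths of `N / η` form a self-conjugate partition `t`, then
`c^{η^c + η'}_{N^c, N'}` is positive. -/
theorem LRcoeff_complAddConj_pos {eta N t : ℕ → ℕ} {m K r0 : ℕ} (heta : IsPartition eta)
    (hN : IsPartition N) (hm : N 0 + K ≤ m) (hK : N K = 0)
    (ht : ∀ a x, x < t a ↔ a < t x) (hlow : ∀ j, j < r0 → N j = eta j)
    (hrow : ∀ a, N (r0 + a) = eta (r0 + a) + t a) :
    0 < LRcoeff (complAddConj m eta) (complP m N) (conjP N) := by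
  have hsub : subP eta N := by
    intro j
    by_cases hj : j < r0
    · exact (hlow j hj).ge
    · have := hrow (j - r0)
      rw [Nat.add_sub_cancel' (by omega)] at this
      omega
  have hshape := inShape_complAddConj_iff heta hN hsub hm hK
  have hlam := heta.complAddConj m
  have hsubP : subP (complP m N) (complAddConj m eta) := by
    intro i
    unfold complAddConj complP
    have := hsub (m - 1 - i)
    split_ifs <;> omega
  have hB : ∀ k, N 0 ≤ k → conjP N k = 0 := by
    intro k hk
    have := hN.lt_conjP 0 k
    omega
  have := LRTableau.finite (alpha := complP m N) hlam hB
  rw [LRcoeff, if_pos hsubP]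
  suffices Nonempty (LRTableau (complAddConj m eta) (complP m N) (conjP N)) from Nat.card_pos
  -- the cell `(j, b)` of `N / η` carries `colVal j b + 1` and is matched with row `rowVal j b`
  set rowVal : ℕ → ℕ → ℕ := fun j b => r0 + (b - eta j) with h_rowVal
  set colVal : ℕ → ℕ → ℕ := fun j b => N (rowVal j b) - 1 - (j - r0) with h_colVal
  have hge : ∀ j b, eta j ≤ b → b < N j → r0 ≤ j := by
    intro j b h1 h2
    by_contra! hcon
    have := hlow j hcon
    omega
  have hskew : ∀ j b, eta j ≤ b → b < N j →
      eta (rowVal j b) + (j - r0) < N (rowVal j b) := by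
    intro j b h1 h2
    have h0 := hge j b h1 h2
    have h3 := hrow (j - r0)
    rw [Nat.add_sub_cancel' h0] at h3
    have h4 := hrow (b - eta j)
    have h5 := (ht (j - r0) (b - eta j)).1 (by omega)
    simp only [h_rowVal]
    omega
  have hNm : ∀ j b, b < N j → j < m ∧ b < m := by
    intro j b h
    have h0 := hN.1 (Nat.zero_le j)
    have : j < K := by
      by_contra! hcon
      have := hN.1 hcon
      omega
    omega
  have hrowlt : ∀ p v, v < eta p → v < m := by
    intro p v h
    exact (hNm p v (lt_of_lt_of_le h (hsub p))).2
  classical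
  refine nonempty_LRTableau_of_matching hlam
    (fun r c => if inShape (complAddConj m eta) (complP m N) r c then
      (if m ≤ c then r + 1 else colVal (m - 1 - r) (m - 1 - c) + 1) else 0)
    (fun x => if m ≤ x.2 then x.2 - m else rowVal (m - 1 - x.1) (m - 1 - x.2))
    (fun p v => if v < eta p then (v, m + p) else
      (m - 1 - (r0 + (N p - 1 - v)), m - 1 - (eta (r0 + (N p - 1 - v)) + (p - r0))))
    ?_ ?_ ?_ ?_ ?_ ?_ ?_
  · intro r c h
    simp only [if_neg h]
  · intro r c h
    simp only [if_pos h]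
    split_ifs <;> omega
  · intro r c₁ c₂ hc h₁ h₂
    simp only [if_pos h₁, if_pos h₂]
    have g1 := (hshape _ _).1 h₁
    have g2 := (hshape _ _).1 h₂
    by_cases hc1 : m ≤ c₁
    · rw [if_pos hc1, if_pos (by omega)]
    · by_cases hc2 : m ≤ c₂
      · have := heta.1 (Nat.zero_le (c₂ - m))
        have h3 := hN.1 (Nat.zero_le (m - 1 - r))
        have h4 := hsub 0
        have : m - 1 - r < K := by
          by_contra! hcon
          have := hN.1 hcon
          omega
        omega
      · rw [if_neg hc1, if_neg hc2]
        have : rowVal (m - 1 - r) (m - 1 - c₂) ≤ rowVal (m - 1 - r) (m - 1 - c₁) := by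
          simp only [h_rowVal]
          omega
        have := hN.1 this
        simp only [h_colVal]
        omega
  · intro r₁ r₂ c hr h₁ h₂
    simp only [if_pos h₁, if_pos h₂]
    have g1 := (hshape _ _).1 h₁
    have g2 := (hshape _ _).1 h₂
    by_cases hc : m ≤ c
    · rw [if_pos hc, if_pos hc]
      omega
    · rw [if_neg hc, if_neg hc]
      obtain ⟨a1, a2, a3, a4⟩ := g1.resolve_left (by omega)
      obtain ⟨b1, b2, b3, b4⟩ := g2.resolve_left (by omega)
      have h3 := heta.1 (show m - 1 - r₂ ≤ m - 1 - r₁ by omega)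
      have : rowVal (m - 1 - r₂) (m - 1 - c) ≤ rowVal (m - 1 - r₁) (m - 1 - c) := by
        simp only [h_rowVal]
        omega
      have := hN.1 this
      have := hskew _ _ a3 a4
      have := hskew _ _ b3 b4
      have := hge _ _ a3 a4
      have := hge _ _ b3 b4
      simp only [h_colVal]
      omega
  · intro r c v h he
    simp only [if_pos h] at he ⊢
    have g := (hshape _ _).1 h
    by_cases hc : m ≤ c
    · rw [if_pos hc] at he ⊢
      obtain ⟨_, g2⟩ := g.resolve_right (by omega)
      have hv : v = r := by omega
      subst hv
      have := hsub (c - m)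
      refine ⟨by omega, ?_⟩
      rw [if_pos g2, Nat.add_sub_cancel' hc]
    · rw [if_neg hc] at he ⊢
      obtain ⟨a1, a2, a3, a4⟩ := g.resolve_left (by omega)
      have h1 := hskew _ _ a3 a4
      have h0 := hge _ _ a3 a4
      have hv : v = N (rowVal (m - 1 - r) (m - 1 - c)) - 1 - (m - 1 - r - r0) := by
        simp only [h_colVal] at he
        omega
      refine ⟨by omega, ?_⟩
      rw [if_neg (by omega)]
      have e1 : r0 + (N (rowVal (m - 1 - r) (m - 1 - c)) - 1 - v) = m - 1 - r := by omega
      rw [e1]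
      have e2 : rowVal (m - 1 - r) (m - 1 - c) - r0 = m - 1 - c - eta (m - 1 - r) := by
        simp only [h_rowVal]
        omega
      rw [e2]
      exact Prod.ext (by simp only; omega) (by simp only; omega)
  · intro p v hv
    by_cases hp : v < eta p
    · have hin : inShape (complAddConj m eta) (complP m N) v (m + p) := by
        rw [hshape]
        left
        simpa using hp
      simp only [if_pos hp]
      simp [hin]
    · simp only [if_neg hp]
      push Not at hp
      have h0 := hge p v hp hv
      have h3 := hrow (p - r0)
      rw [Nat.add_sub_cancel' h0] at h3
      have h4 := hrow (N p - 1 - v)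
      have h5 := (ht (p - r0) (N p - 1 - v)).1 (by omega)
      set j := r0 + (N p - 1 - v) with hj
      have hjm := hNm j (eta j + (p - r0)) (by omega)
      have hin : inShape (complAddConj m eta) (complP m N) (m - 1 - j)
          (m - 1 - (eta j + (p - r0))) := by
        rw [hshape]
        right
        rw [Nat.sub_sub_self (by omega), Nat.sub_sub_self (by omega)]
        omega
      have hrv : rowVal j (eta j + (p - r0)) = p := by
        simp only [h_rowVal]
        omega
      refine ⟨hin, ?_, ?_⟩
      · rw [if_pos hin, if_neg (by omega), Nat.sub_sub_self (by omega),
          Nat.sub_sub_self (by omega)]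
        simp only [h_colVal, hrv]
        omega
      · rw [if_neg (by omega), Nat.sub_sub_self (by omega), Nat.sub_sub_self (by omega), hrv]
  · intro p v hv
    have hb : ∀ w, eta p ≤ w → w < N p → r0 + (N p - 1 - w) < K := by
      intro w h1 h2
      have h0 := hge p w h1 h2
      have h3 := hrow (p - r0)
      rw [Nat.add_sub_cancel' h0] at h3
      have h4 := hrow (N p - 1 - w)
      have h5 := (ht (p - r0) (N p - 1 - w)).1 (by omega)
      by_contra! hcon
      have := hN.1 hcon
      omega
    by_cases h1 : v < eta p
    · by_cases h2 : v + 1 < eta p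
      · simp only [if_pos h1, if_pos h2]
        omega
      · simp only [if_pos h1, if_neg h2]
        have := hb (v + 1) (by omega) hv
        have := hN.1 (Nat.zero_le p)
        omega
    · simp only [if_neg h1, if_neg (show ¬ v + 1 < eta p by omega)]
      have := hb v (by omega) (by omega)
      omega

section Vanishing

variable {eta N : ℕ → ℕ} {m K : ℕ}

/-- The cells of the copy of `η'` in an LR tableau of shape `(η^c + η') / N^c` carry the entries
of the unique LR tableau of shape `η'`. -/
theorem LRTableau.entry_conj_part (heta : IsPartition eta)
    (hN : IsPartition N) (hsub : subP eta N) (hm : N 0 + K ≤ m) (hK : N K = 0)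
    (T : LRTableau (complAddConj m eta) (complP m N) (conjP N)) {r p : ℕ} (h : r < eta p) :
    T.entry r (m + p) = r + 1 := by
  have hshape := inShape_complAddConj_iff heta hN hsub hm hK
  have hin : ∀ r p, r < eta p → inShape (complAddConj m eta) (complP m N) r (m + p) := by
    intro r p h
    rw [hshape]
    left
    simpa using h
  have hconv : ∀ r c, r < eta 0 → inShape (complAddConj m eta) (complP m N) r c →
      m ≤ c ∧ r < eta (c - m) := by
    intro r c hr h
    rcases (hshape r c).1 h with h | ⟨h1, h2, h3, h4⟩
    · exact h
    · have := hsub 0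
      have : m - 1 - r < K := by
        by_contra! hcon
        have := hN.1 hcon
        omega
      omega
  have lower : ∀ r p, r < eta p → r + 1 ≤ T.entry r (m + p) := by
    intro r
    induction r with
    | zero => exact fun p h => T.one_le _ _ (hin 0 p h)
    | succ r ih =>
      intro p h
      have h1 := ih p (by omega)
      have h2 := T.col_strict r (r + 1) (m + p) (by omega) (hin r p (by omega)) (hin _ p h)
      omega
  have upper : ∀ r p, r < eta p → T.entry r (m + p) ≤ r + 1 := by
    intro r
    induction r using Nat.strong_induction_on with
    | _ r ih =>
      intro p h
      set q := conjP eta r - 1 with hq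
      have hp : p < conjP eta r := (heta.lt_conjP _ _).2 h
      have hqr : r < eta q := (heta.lt_conjP _ _).1 (by omega)
      have hw := T.row_weak r (m + p) (m + q) (by omega) (hin r p h) (hin r q hqr)
      refine hw.trans ?_
      by_contra! hcon
      have hl := T.lattice r (m + q) (T.entry r (m + q) - 2) (hin r q hqr)
      have hfin : Finite {x : ℕ × ℕ // inShape (complAddConj m eta) (complP m N) x.1 x.2 ∧
          (x.1 < r ∨ (x.1 = r ∧ m + q ≤ x.2)) ∧
          T.entry x.1 x.2 = T.entry r (m + q) - 2 + 2} :=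
        (finite_inShape_and (heta.complAddConj m) (complP m N) _).to_subtype
      have hpos : 0 < Nat.card {x : ℕ × ℕ // inShape (complAddConj m eta) (complP m N) x.1 x.2 ∧
          (x.1 < r ∨ (x.1 = r ∧ m + q ≤ x.2)) ∧
          T.entry x.1 x.2 = T.entry r (m + q) - 2 + 2} := by
        have : Nonempty {x : ℕ × ℕ // inShape (complAddConj m eta) (complP m N) x.1 x.2 ∧
          (x.1 < r ∨ (x.1 = r ∧ m + q ≤ x.2)) ∧
          T.entry x.1 x.2 = T.entry r (m + q) - 2 + 2} :=
          ⟨⟨(r, m + q), hin r q hqr, Or.inr ⟨rfl, le_rfl⟩, by simp only; omega⟩⟩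
        exact Nat.card_pos
      have hpos' := lt_of_lt_of_le hpos hl
      obtain ⟨⟨⟨a, b⟩, h1, h2, h3⟩⟩ := (Nat.card_pos_iff.1 hpos').1
      simp only at h1 h2 h3
      have hr0 := heta.1 (Nat.zero_le q)
      obtain ⟨h4, h5⟩ := hconv a b (by omega) h1
      rcases h2 with h2 | ⟨rfl, h2⟩
      · have := ih a h2 (b - m) h5
        rw [Nat.add_sub_cancel' h4] at this
        omega
      · have := (heta.lt_conjP _ _).2 h5
        have hbq : b = m + q := by omega
        rw [hbq] at h3
        omega
  exact le_antisymm (upper r p h) (lower r p h)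

/-- In an LR tableau of shape `(η^c + η') / N^c` and content `N'`, the entries in the rotated copy
of `N / η` index nonempty columns of `N / η`. -/
theorem LRTableau.exists_of_entry_skew_part (heta : IsPartition eta)
    (hN : IsPartition N) (hsub : subP eta N) (hm : N 0 + K ≤ m) (hK : N K = 0)
    (T : LRTableau (complAddConj m eta) (complP m N) (conjP N)) {r c v : ℕ}
    (hin : inShape (complAddConj m eta) (complP m N) r c) (hc : c < m)
    (hv : T.entry r c = v + 1) : ∃ j, eta j ≤ v ∧ v < N j := by
  by_contra! hcon
  have hshape := inShape_complAddConj_iff heta hN hsub hm hK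
  have hlt : ∀ j, v < N j → v < eta j := by
    intro j hj
    by_contra! h
    have := hcon j h
    omega
  let F : {j : ℕ // v < N j} →
      {p : ℕ × ℕ // inShape (complAddConj m eta) (complP m N) p.1 p.2 ∧
        T.entry p.1 p.2 = v + 1} := fun j =>
    ⟨(v, m + j.1), (hshape _ _).2 (Or.inl ⟨by simp, by simpa using hlt _ j.2⟩),
      T.entry_conj_part heta hN hsub hm hK (hlt _ j.2)⟩
  have hF : Function.Injective F := by
    intro i j hij
    have := congrArg (fun x => x.1.2) hij
    simp only [F] at this
    exact Subtype.ext (by omega)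
  have hfin : Finite {p : ℕ × ℕ // inShape (complAddConj m eta) (complP m N) p.1 p.2 ∧
      T.entry p.1 p.2 = v + 1} :=
    (finite_inShape_and (heta.complAddConj m) (complP m N) _).to_subtype
  have hbij := hF.bijective_of_nat_card_le (T.content v).le
  obtain ⟨j, hj⟩ := hbij.2 ⟨(r, c), hin, hv⟩
  have := congrArg (fun x => x.1.2) hj
  simp only [F] at this
  omega

end Vanishing

/-- Lattice permutations contain at least as many entries `a + 1` as entries `b + 1` for
`a ≤ b`. -/
theorem LRTableau.lattice_le {lam alpha beta : ℕ → ℕ} (T : LRTableau lam alpha beta)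
    {r c a b : ℕ} (hin : inShape lam alpha r c) (hab : a ≤ b) :
    {p : ℕ × ℕ | inShape lam alpha p.1 p.2 ∧
        (p.1 < r ∨ (p.1 = r ∧ c ≤ p.2)) ∧ T.entry p.1 p.2 = b + 1}.ncard ≤
    {p : ℕ × ℕ | inShape lam alpha p.1 p.2 ∧
        (p.1 < r ∨ (p.1 = r ∧ c ≤ p.2)) ∧ T.entry p.1 p.2 = a + 1}.ncard := by
  induction b, hab using Nat.le_induction with
  | base => exact le_rfl
  | succ b _ ih => exact (T.lattice r c b hin).trans ih

/-- The prefix of the reverse reading word ending at the `(d + 1)`-st cell from the right of a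
row segment contains at least `d + 1` copies of the entry of that cell. -/
theorem LRTableau.lt_ncard_of_row {lam alpha beta : ℕ → ℕ} (hlam : IsPartition lam)
    (T : LRTableau lam alpha beta) {r c d : ℕ}
    (hin : ∀ e, e ≤ d → inShape lam alpha r (c + e)) :
    d < {p : ℕ × ℕ | inShape lam alpha p.1 p.2 ∧
        (p.1 < r ∨ (p.1 = r ∧ c ≤ p.2)) ∧ T.entry p.1 p.2 = T.entry r c}.ncard := by
  induction d generalizing c with
  | zero =>
    rw [Set.ncard_pos (finite_inShape_and hlam alpha _)]
    exact ⟨(r, c), hin 0 le_rfl, Or.inr ⟨rfl, le_rfl⟩, rfl⟩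
  | succ d ih =>
    have h0 : inShape lam alpha r c := hin 0 (by omega)
    have h1 : inShape lam alpha r (c + 1) := hin 1 (by omega)
    have hd := ih (c := c + 1) fun e he => by
      have := hin (e + 1) (by omega)
      rwa [show c + (e + 1) = c + 1 + e by omega] at this
    have hw := T.row_weak r c (c + 1) (by omega) h0 h1
    have p0 := T.one_le _ _ h0
    have hl := T.lattice_le h1 (show T.entry r c - 1 ≤ T.entry r (c + 1) - 1 by omega)
    rw [Nat.sub_add_cancel p0, Nat.sub_add_cancel (by omega)] at hl
    refine lt_of_le_of_lt (Nat.succ_le_of_lt (hd.trans_le hl)) ?_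
    refine Set.ncard_lt_ncard ?_ (finite_inShape_and hlam alpha _)
    refine Set.ssubset_iff_exists.2 ⟨?_, (r, c), ⟨h0, Or.inr ⟨rfl, le_rfl⟩, rfl⟩, ?_⟩
    · rintro ⟨a, b⟩ ⟨h2, h3, h4⟩
      refine ⟨h2, ?_, h4⟩
      simp only at *
      omega
    · rintro ⟨_, h3, _⟩
      simp only at h3
      omega

theorem LRTableau.lt_content_of_row {lam alpha beta : ℕ → ℕ} (hlam : IsPartition lam)
    (T : LRTableau lam alpha beta) {r c d v : ℕ}
    (hin : ∀ e, e ≤ d → inShape lam alpha r (c + e)) (hv : T.entry r c = v + 1) :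
    d < beta v := by
  rw [← T.content v]
  refine (T.lt_ncard_of_row hlam hin).trans_le ?_
  rw [hv]
  exact Set.ncard_le_ncard (fun p hp => ⟨hp.1, hp.2.2⟩) (finite_inShape_and hlam alpha _)

theorem LRcoeff_eq_zero {lam alpha beta : ℕ → ℕ} (h : LRTableau lam alpha beta → False) :
    LRcoeff lam alpha beta = 0 := by
  have : IsEmpty (LRTableau lam alpha beta) := ⟨h⟩
  unfold LRcoeff
  split_ifs
  · exact Nat.card_of_isEmpty
  · rfl

/-- `c^{η^c + η'}_{N^c, N'}` vanishes if `N / η` lives in rows `0, …, s - 1` and has a row of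
length at least `s + 1`. -/
theorem LRcoeff_eq_zero_of_long_row {eta N : ℕ → ℕ} {m K s r : ℕ} (heta : IsPartition eta)
    (hN : IsPartition N) (hsub : subP eta N) (hm : N 0 + K ≤ m) (hK : N K = 0)
    (hrows : ∀ j, s ≤ j → N j = eta j) (hlong : eta r + s < N r) :
    LRcoeff (complAddConj m eta) (complP m N) (conjP N) = 0 := by
  refine LRcoeff_eq_zero fun T => ?_
  have hshape := inShape_complAddConj_iff heta hN hsub hm hK
  have hrK : r < K := by
    by_contra! hcon
    have := hN.1 hcon
    omega
  have h0 := hN.1 (Nat.zero_le r)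
  set c := m - 1 - (eta r + s) with hc
  have hin : ∀ e, e ≤ s → inShape (complAddConj m eta) (complP m N) (m - 1 - r) (c + e) := by
    intro e he
    rw [hshape]
    right
    rw [Nat.sub_sub_self (by omega)]
    omega
  have hin0 := hin 0 (by omega)
  have h1 := T.one_le _ _ hin0
  obtain ⟨v, hv⟩ : ∃ v, T.entry (m - 1 - r) c = v + 1 := ⟨_, (Nat.sub_add_cancel h1).symm⟩
  have h2 := T.lt_content_of_row (heta.complAddConj m) hin hv
  rw [hN.lt_conjP, hrows s le_rfl] at h2
  obtain ⟨j, hj1, hj2⟩ := T.exists_of_entry_skew_part heta hN hsub hm hK hin0 (by omega) hv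
  rcases le_total s j with h | h
  · have := hrows j h
    omega
  · have := heta.1 h
    omega

/-- `c^{η^c + η'}_{N^c, N'}` vanishes if `N / η` lives in columns `c, …, c + L - 1` and has at
least `L + 1` cells in column `c`. -/
theorem LRcoeff_eq_zero_of_long_column {eta N : ℕ → ℕ} {m K R c L : ℕ} (heta : IsPartition eta)
    (hN : IsPartition N) (hsub : subP eta N) (hm : N 0 + K ≤ m) (hK : N K = 0)
    (hcols : ∀ j v, eta j ≤ v → v < N j → c ≤ v ∧ v < c + L)
    (hlong : ∀ a, a ≤ L → eta (R + a) ≤ c ∧ c < N (R + a)) :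
    LRcoeff (complAddConj m eta) (complP m N) (conjP N) = 0 := by
  refine LRcoeff_eq_zero fun T => ?_
  have hshape := inShape_complAddConj_iff heta hN hsub hm hK
  have hRK : R + L < K := by
    by_contra! hcon
    have := hN.1 hcon
    have := hlong L le_rfl
    omega
  have h0 := hN.1 (Nat.zero_le (R + L))
  have hL := hlong L le_rfl
  have hin : ∀ a, a ≤ L →
      inShape (complAddConj m eta) (complP m N) (m - 1 - (R + a)) (m - 1 - c) := by
    intro a ha
    rw [hshape]
    right
    rw [Nat.sub_sub_self (by omega), Nat.sub_sub_self (by omega)]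
    have := hlong a ha
    omega
  have hbd : ∀ a, a ≤ L → c < T.entry (m - 1 - (R + a)) (m - 1 - c) ∧
      T.entry (m - 1 - (R + a)) (m - 1 - c) ≤ c + L := by
    intro a ha
    have h1 := T.one_le _ _ (hin a ha)
    obtain ⟨j, h2, h3⟩ := T.exists_of_entry_skew_part heta hN hsub hm hK (hin a ha) (by omega)
      (Nat.sub_add_cancel h1).symm
    have := hcols j _ h2 h3
    omega
  have hchain : ∀ d, d ≤ L → c + d < T.entry (m - 1 - (R + (L - d))) (m - 1 - c) := by
    intro d
    induction d with
    | zero => exact fun _ => (hbd _ le_rfl).1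
    | succ d ih =>
      intro hd
      have h1 := ih (by omega)
      have h2 := T.col_strict (m - 1 - (R + (L - d))) (m - 1 - (R + (L - (d + 1)))) (m - 1 - c)
        (by omega) (hin _ (by omega)) (hin _ (by omega))
      omega
  have h1 := hchain L le_rfl
  have h2 := hbd (L - L) (by omega)
  omega

theorem squareP_lt_symm (s a x : ℕ) : x < squareP s a ↔ a < squareP s x := by
  unfold squareP
  split_ifs <;> omega

theorem IsPartition.add {f g : ℕ → ℕ} (hf : IsPartition f) (hg : IsPartition g) :
    IsPartition fun j => f j + g j := by
  refine ⟨fun a b hab => Nat.add_le_add (hf.1 hab) (hg.1 hab), ?_⟩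
  obtain ⟨M, hM⟩ := hf.2
  obtain ⟨N, hN⟩ := hg.2
  refine ⟨max M N, ?_⟩
  have h1 := hf.1 (le_max_left M N)
  have h2 := hg.1 (le_max_right M N)
  show f _ + g _ = 0
  omega

theorem isPartition_squareP (s : ℕ) : IsPartition (squareP s) := by
  refine ⟨fun a b hab => ?_, s, by simp [squareP]⟩
  unfold squareP
  split_ifs <;> omega

theorem not_covers_of_LRcoeff {nu mu eta : ℕ → ℕ} (heta : IsPartition eta)
    (hpos : 0 < LRcoeff (complAddConj (mu 0 + plen mu) eta) (complP (mu 0 + plen mu) nu) (conjP nu))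
    (hzero : LRcoeff (complAddConj (mu 0 + plen mu) eta) (complP (mu 0 + plen mu) mu)
      (conjP mu) = 0) : ¬ Covers mu nu := by
  intro hcov
  have := hcov _ le_rfl _ (heta.complAddConj (mu 0 + plen mu))
  omega

/-- a type-2 partition `ν = β + (s^s) + α` such that `ν_{(s)}` is
corner-symmetric is not covered by any partition `μ ⊇ ν` with `|μ| = |ν| + 1` other
than `β + (s^s, 1) + α`. -/
theorem type2_corner_symmetric_tail (nu beta alpha : ℕ → ℕ) (s : ℕ)
    (h : IsType2Decomp nu beta s alpha)
    (hcs : CornerSymmetric (rowDel s nu))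
    (mu : ℕ → ℕ) (hmu : IsPartition mu) (hsub : subP nu mu)
    (hsz : psize mu = psize nu + 1)
    (hne : mu ≠ fun j => beta j + squareP1 s j + alpha j) :
    ¬ Covers mu nu := by
  obtain ⟨hbeta, halpha, hs, _, _, _, hdec⟩ := h
  have hnu : IsPartition nu := by
    have : nu = fun j => beta j + squareP s j + alpha j := funext hdec
    rw [this]
    exact (hbeta.add (isPartition_squareP s)).add halpha
  obtain ⟨r, hr, hother⟩ := exists_row_of_psize_succ hnu hmu hsub hsz
  have hKmu : mu (plen mu) = 0 := hmu.eq_zero_of_plen_le le_rfl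
  have hKnu : nu (plen mu) = 0 := by
    have := hsub (plen mu)
    omega
  have hmnu : nu 0 + plen mu ≤ mu 0 + plen mu := Nat.add_le_add_right (hsub 0) _
  rcases lt_trichotomy r s with hrs | hrs | hrs
  · have heta := hbeta.add halpha
    have hrow : ∀ a, nu (0 + a) = (beta (0 + a) + alpha (0 + a)) + squareP s a := by
      intro a
      rw [hdec, Nat.zero_add]
      omega
    refine not_covers_of_LRcoeff heta
      (LRcoeff_complAddConj_pos heta hnu hmnu hKnu (squareP_lt_symm s)
        (fun j hj => absurd hj (Nat.not_lt_zero j)) hrow)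
      (LRcoeff_eq_zero_of_long_row (s := s) (r := r) heta hmu ?_ le_rfl hKmu ?_ ?_)
    · intro j
      have h1 := hrow j
      have h2 := hsub j
      rw [Nat.zero_add] at h1
      simp only
      omega
    · intro j hj
      have h1 := hrow j
      have h2 := hother j (by omega)
      rw [Nat.zero_add, squareP, if_neg (by omega)] at h1
      omega
    · have h1 := hrow r
      rw [Nat.zero_add, squareP, if_pos hrs] at h1
      omega
  · refine absurd (funext fun j => ?_) hne
    have h1 := hdec j
    unfold squareP at h1
    unfold squareP1
    by_cases hj : j = r
    · subst hj
      rw [if_neg (by omega)] at h1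
      rw [if_neg (by omega), if_pos hrs]
      omega
    · rw [hother j hj, h1]
      split_ifs <;> omega
  · obtain ⟨k, rfl⟩ : ∃ k, r = k + s := ⟨r - s, by omega⟩
    have hk1 : 1 ≤ k := by omega
    have hcorner : nu (k + s) < nu (k - 1 + s) := by
      have h1 := hmu.1 (show k - 1 + s ≤ k + s by omega)
      have h2 := hother (k - 1 + s) (by omega)
      omega
    obtain ⟨eta, heta, hetasub, -, t, r0, c0, ht, hself, hskew, hcell, hcols⟩ :=
      hcs k hk1 hcorner
    simp only [rowDel] at hetasub hskew hcell hcols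
    simp only [subP, rowDel] at hetasub
    have htsymm : ∀ a x, x < t a ↔ a < t x := by
      intro a x
      rw [← ht.lt_conjP a x, hself]
    have h1 := (hskew (k - 1) (nu (k + s))).1 ⟨hcell, hcorner⟩
    have ht0 : 0 < t 0 := lt_of_lt_of_le (by omega) (ht.1 (Nat.zero_le (k - 1 - r0)))
    obtain ⟨h2, h3⟩ := (hskew r0 c0).2 ⟨le_rfl, le_rfl, by simpa using ht0⟩
    have hc0 : nu (k + s) = c0 := le_antisymm (hcols r0 c0 h2 h3) h1.2.1
    have htk : t (k - r0) = 0 := by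
      by_contra hcon
      have := (hskew k c0).2 ⟨by omega, le_rfl, by omega⟩
      omega
    have hlen : r0 + t 0 = k := by
      have h4 := htsymm (k - 1 - r0) 0
      have h5 := htsymm (k - r0) 0
      omega
    have hetak : eta k = nu (k + s) := by
      refine le_antisymm (hetasub k) ?_
      by_contra! hcon
      have := (hskew k (eta k)).1 ⟨le_rfl, hcon⟩
      omega
    have hlow : ∀ a, a < r0 → nu (a + s) = eta a := by
      intro a ha
      refine le_antisymm ?_ (hetasub a)
      by_contra! hcon
      have := (hskew a (eta a)).1 ⟨le_rfl, hcon⟩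
      omega
    have hrow : ∀ a, nu (r0 + a + s) = eta (r0 + a) + t a := by
      intro a
      have h4 := hskew (r0 + a)
      simp only [Nat.add_sub_cancel_left] at h4
      have h5 := hetasub (r0 + a)
      rcases Nat.eq_zero_or_pos (t a) with h0 | h0
      · have := h4 (eta (r0 + a))
        omega
      · have g1 := h4 c0
        have g2 := h4 (eta (r0 + a))
        have g3 := h4 (c0 + t a - 1)
        have g4 := h4 (nu (r0 + a + s) - 1)
        omega
    let eta' : ℕ → ℕ := fun j => if j < s then nu j else eta (j - s)
    have heta' : IsPartition eta' := by
      constructor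
      · intro a b hab
        have h4 := hnu.1 hab
        have h5 := heta.1 (show a - s ≤ b - s by omega)
        have h6 := hetasub (b - s)
        simp only [eta']
        by_cases hb : b < s
        · rw [if_pos hb, if_pos (by omega)]
          exact h4
        · rw [Nat.sub_add_cancel (by omega)] at h6
          rw [if_neg hb]
          split_ifs <;> omega
      · obtain ⟨M, hM⟩ := heta.2
        refine ⟨M + s, ?_⟩
        simp only [eta']
        rw [if_neg (by omega), Nat.add_sub_cancel, hM]
    have heta'sub : subP eta' nu := by
      intro j
      simp only [eta']
      split_ifs with hj
      · exact le_rfl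
      · have := hetasub (j - s)
        rwa [Nat.sub_add_cancel (by omega)] at this
    have heta'add : ∀ a, eta' (a + s) = eta a := by
      intro a
      simp [eta']
    refine not_covers_of_LRcoeff heta'
      (LRcoeff_complAddConj_pos (r0 := r0 + s) heta' hnu hmnu hKnu htsymm ?_ ?_)
      (LRcoeff_eq_zero_of_long_column (R := r0 + s) (c := c0) (L := t 0) heta' hmu
        (fun j => (heta'sub j).trans (hsub j)) le_rfl hKmu ?_ ?_)
    · intro j hj
      by_cases hjs : j < s
      · simp [eta', hjs]
      · obtain ⟨a, rfl⟩ : ∃ a, j = a + s := ⟨j - s, by omega⟩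
        rw [heta'add]
        exact hlow a (by omega)
    · intro a
      rw [show r0 + s + a = r0 + a + s by omega, heta'add]
      exact hrow a
    · intro j v hv1 hv2
      by_cases hjs : j < s
      · have := hother j (by omega)
        simp only [eta', if_pos hjs] at hv1
        omega
      · obtain ⟨a, rfl⟩ : ∃ a, j = a + s := ⟨j - s, by omega⟩
        rw [heta'add] at hv1
        by_cases hak : a = k
        · subst hak
          omega
        · rw [hother _ (by omega)] at hv2
          have h4 := (hskew a v).1 ⟨hv1, hv2⟩
          have := ht.1 (Nat.zero_le (a - r0))
          omega
    · intro a ha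
      rw [show r0 + s + a = r0 + a + s by omega, heta'add]
      rcases ha.lt_or_eq with ha | rfl
      · have h4 := (htsymm a 0).2 ha
        have h5 := (hskew (r0 + a) c0).2
          ⟨by omega, le_rfl, by rw [Nat.add_sub_cancel_left]; omega⟩
        have := hsub (r0 + a + s)
        omega
      · rw [hlen, hr, hetak]
        omega
end

section
/- If ν is a nonempty partition such that both ν and its conjugate ν' are corner-symmetric, then ν is neither of type 1 nor of type 2. -/
lemma conjP_eq_of_forall_lt_iff {f : ℕ → ℕ} {j n : ℕ} (h : ∀ k, j < f k ↔ k < n) :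
    conjP f j = n := by
  simp only [conjP, h]
  rw [Nat.card_congr Fin.equivSubtype.symm, Nat.card_fin]

lemma IsPartition.lt_conjP_iff {f : ℕ → ℕ} (hf : IsPartition f) (j k : ℕ) :
    k < conjP f j ↔ j < f k := by
  classical
  obtain ⟨hanti, N, hN⟩ := hf
  have hex : ∃ n, f n ≤ j := ⟨N, by omega⟩
  have h : ∀ k, j < f k ↔ k < Nat.find hex := fun k => by
    rw [Nat.lt_find_iff]
    exact ⟨fun hk m hm => not_le.2 (hk.trans_le (hanti hm)), fun hk => not_le.1 (hk k le_rfl)⟩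
  rw [conjP_eq_of_forall_lt_iff h, h]

lemma IsPartition.antitone_conjP {f : ℕ → ℕ} (hf : IsPartition f) : Antitone (conjP f) := by
  intro a b hab
  by_contra! hlt
  have := (hf.lt_conjP_iff b _).1 hlt
  exact lt_irrefl _ ((hf.lt_conjP_iff a _).2 (hab.trans_lt this))

/-- The self-conjugate subdiagram attached to an outer corner is as wide as it is tall. -/
lemma CornerSymmetric.exists_row {nu : ℕ → ℕ} (hcs : CornerSymmetric nu) (hnu : Antitone nu)
    {r : ℕ} (hr : 1 ≤ r) (hlt : nu r < nu (r - 1)) :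
    ∃ r0 < r, nu r0 = nu r + (r - r0) := by
  obtain ⟨η, ⟨hη, -⟩, -, -, t, r0, c0, ⟨ht, -⟩, hsc, hcell, hle, hcol⟩ := hcs r hr hlt
  obtain ⟨hr0, hc0, hpos⟩ := (hcell (r - 1) (nu r)).1 ⟨hle, hlt⟩
  have ht0 : 0 < t 0 := (Nat.zero_le _).trans_lt (hpos.trans_le (ht (Nat.zero_le _)))
  obtain ⟨hη0, hν0⟩ := (hcell r0 c0).2 ⟨le_rfl, le_rfl, by simpa using ht0⟩
  have hc : c0 = nu r := le_antisymm hc0 (hcol r0 c0 hη0 hν0)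
  have hwidth : nu r0 = c0 + t 0 := by
    have h₁ := hcell r0 (nu r0)
    have h₂ := hcell r0 (c0 + t 0)
    simp only [Nat.sub_self] at h₁ h₂
    omega
  have hheight : conjP t 0 = r - r0 := conjP_eq_of_forall_lt_iff fun k => by
    have hk := hcell (r0 + k) c0
    simp only [Nat.add_sub_cancel_left, Nat.sub_self] at hk
    have hηk : η (r0 + k) ≤ c0 := (hη (Nat.le_add_right _ _)).trans hη0
    have hνk : c0 < nu (r0 + k) ↔ r0 + k < r := by
      rw [hc]
      refine ⟨fun h => ?_, fun h => hlt.trans_le (hnu (by omega))⟩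
      by_contra! hge
      exact absurd (hnu hge) (not_le.2 h)
    omega
  refine ⟨r0, by omega, ?_⟩
  rw [hwidth, ← hsc 0, hheight, hc]

lemma not_type1_of_cornerSymmetric_conjP {nu : ℕ → ℕ} (hnu : IsPartition nu) (hne : nu 0 ≠ 0)
    (hcs' : CornerSymmetric (conjP nu)) : ¬ Type1 nu := by
  rintro ⟨-, hsub⟩
  have hzero : conjP nu (nu 0) = 0 := by
    by_contra! h
    exact lt_irrefl _ ((hnu.lt_conjP_iff (nu 0) 0).1 (Nat.pos_of_ne_zero h))
  have hpos : 0 < conjP nu (nu 0 - 1) := (hnu.lt_conjP_iff _ _).2 (by omega)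
  obtain ⟨c0, hc0, heq⟩ :=
    hcs'.exists_row hnu.antitone_conjP (r := nu 0) (by omega) (by omega)
  have hlow : nu (nu 0 - c0) ≤ c0 := by
    by_contra! h
    have := (hnu.lt_conjP_iff _ _).2 h
    omega
  have hbeta := hsub (nu 0 - c0)
  simp only [betaShape] at hbeta
  split_ifs at hbeta <;> omega

lemma not_type2_of_cornerSymmetric {nu : ℕ → ℕ} (hnu : IsPartition nu)
    (hcs : CornerSymmetric nu) : ¬ Type2 nu := by
  rintro ⟨beta, s, alpha, hbeta, halpha, hs, hne, hlen, hsub, hdecomp⟩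
  have hconst : ∀ j ≤ s, beta j = beta 0 := fun j hj => by
    have h := hsub j
    rw [betaShape, if_pos (by omega)] at h
    exact le_antisymm (hbeta.1 (Nat.zero_le j)) h
  have halpha_s : alpha s = 0 := by
    have h : alpha (plen alpha) = 0 := Nat.sInf_mem (s := {n | alpha n = 0}) halpha.2
    have := halpha.1 hlen
    omega
  have hrow : ∀ j < s, nu j = beta 0 + s + alpha j := fun j hj => by
    rw [hdecomp, hconst j hj.le, squareP, if_pos hj]
  have hrow_s : nu s = beta 0 := by
    rw [hdecomp, hconst s le_rfl, squareP, if_neg (lt_irrefl s), halpha_s, add_zero, add_zero]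
  obtain ⟨r0, hr0, heq⟩ := hcs.exists_row hnu.1 hs (by rw [hrow_s, hrow _ (by omega)]; omega)
  rw [hrow _ hr0, hrow_s] at heq
  obtain rfl : r0 = 0 := by omega
  omega

/-- if both `ν` and `ν'` are corner-symmetric (`ν` nonempty), then `ν` is
neither of type 1 nor of type 2. -/
theorem doubly_corner_symmetric_not_type (nu : ℕ → ℕ)
    (hnu : IsPartition nu) (hne : nu 0 ≠ 0)
    (hcs : CornerSymmetric nu) (hcs' : CornerSymmetric (conjP nu)) :
    ¬ Type1 nu ∧ ¬ Type2 nu := by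
  exact ⟨not_type1_of_cornerSymmetric_conjP hnu hne hcs', not_type2_of_cornerSymmetric hnu hcs⟩
end
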